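/- arXiv:2211.05947 — 5 statements merged into one kernel-verified Lean document; each statement's English description precedes it below -/
import Mathlib

section
/- Let b be a minimizer over B of b' ↦ r(b') + (1/2)‖A b' − y‖², and let b̃ be a minimizer over B of b' ↦ r(b') + (1/2)‖A b' − ỹ‖². Then ‖A b̃ − A b‖² ≤ ⟪ỹ − y, A b̃ − A b⟫. -/
open RealInnerProductSpace

/-- First-order optimality condition: if `b` minimizes `r + (1/2)‖A · - y‖²` with `r` convex,
then `y - A b`, pulled back along `A`, is a subgradient of `r` at `b`. -/
theorem ConvexOn.add_inner_le_of_forall_add_half_norm_sq_le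
    {B E : Type*} [AddCommGroup B] [Module ℝ B] [NormedAddCommGroup E] [InnerProductSpace ℝ E]
    {A : B →ₗ[ℝ] E} {y : E} {r : B → ℝ} (hr : ConvexOn ℝ Set.univ r) {b : B}
    (hb : ∀ b' : B, r b + (1 / 2) * ‖A b - y‖ ^ 2 ≤ r b' + (1 / 2) * ‖A b' - y‖ ^ 2) (c : B) :
    r b + inner ℝ (y - A b) (A c - A b) ≤ r c := by
  set v := A c - A b with hv
  have hsegment : ∀ t : ℝ, 0 < t → t ≤ 1 →
      0 ≤ r c - r b - inner ℝ (y - A b) v + t / 2 * ‖v‖ ^ 2 := by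
    intro t ht ht1
    have hconv := hr.2 (Set.mem_univ b) (Set.mem_univ c) (sub_nonneg.2 ht1) ht.le (by ring)
    have hmin := hb ((1 - t) • b + t • c)
    have hres : A ((1 - t) • b + t • c) - y = t • v - (y - A b) := by
      rw [map_add, map_smul, map_smul, hv]
      module
    rw [hres, norm_sub_rev (A b) y, norm_sub_sq_real (t • v), norm_smul, mul_pow, Real.norm_eq_abs, sq_abs,
      real_inner_smul_left, real_inner_comm] at hmin
    simp only [smul_eq_mul] at hconv
    refine nonneg_of_mul_nonneg_right ?_ ht
    linarith
  by_contra! hlt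
  set D := r c - r b - inner ℝ (y - A b) v with hD
  have hDneg : D < 0 := by linarith
  have hN : 0 ≤ ‖v‖ ^ 2 := sq_nonneg _
  have hpos : 0 < ‖v‖ ^ 2 - D := by linarith
  have h := hsegment (-D / (‖v‖ ^ 2 - D)) (div_pos (by linarith) hpos)
    ((div_le_one hpos).2 (by linarith))
  have heq : D + -D / (‖v‖ ^ 2 - D) / 2 * ‖v‖ ^ 2 =
      D * (‖v‖ ^ 2 / 2 - D) / (‖v‖ ^ 2 - D) := by
    field_simp
    ring
  rw [heq] at h
  exact absurd h (not_le.2 (div_neg_of_neg_of_pos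
    (mul_neg_of_neg_of_pos hDneg (by linarith)) hpos))

/-- If `b` minimizes `b' ↦ r b' + (1/2)‖A b' − y‖²` and `b̃` minimizes
`b' ↦ r b' + (1/2)‖A b' − ỹ‖²` over a finite-dimensional real inner product space
`B` (with `r` convex), then `‖A b̃ − A b‖² ≤ ⟪ỹ − y, A b̃ − A b⟫`. -/
theorem stmt_1
    {B : Type*} [NormedAddCommGroup B] [InnerProductSpace ℝ B] [FiniteDimensional ℝ B]
    {d : ℕ} (hd : 0 < d)
    (A : B →ₗ[ℝ] EuclideanSpace ℝ (Fin d)) (y ytil : EuclideanSpace ℝ (Fin d))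
    (r : B → ℝ) (hr : ConvexOn ℝ Set.univ r)
    (b btil : B)
    (hb : ∀ b' : B, r b + (1 / 2) * ‖A b - y‖ ^ 2 ≤ r b' + (1 / 2) * ‖A b' - y‖ ^ 2)
    (hbtil : ∀ b' : B,
      r btil + (1 / 2) * ‖A btil - ytil‖ ^ 2 ≤ r b' + (1 / 2) * ‖A b' - ytil‖ ^ 2) :
    ‖A btil - A b‖ ^ 2 ≤ ⟪ytil - y, A btil - A b⟫ := by
  have h := hr.add_inner_le_of_forall_add_half_norm_sq_le hb btil
  have htil := hr.add_inner_le_of_forall_add_half_norm_sq_le hbtil b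
  rw [← neg_sub (A btil) (A b), inner_neg_right] at htil
  have hsum : ⟪y - A b, A btil - A b⟫ - ⟪ytil - A btil, A btil - A b⟫ =
      ‖A btil - A b‖ ^ 2 - ⟪ytil - y, A btil - A b⟫ := by
    rw [← real_inner_self_eq_norm_sq, ← inner_sub_left, ← inner_sub_left]
    congr 1
    abel
  linarith
end

section
/- Let b be a minimizer over B of b' ↦ r(b') + (1/2)‖A b' − y‖², and let b̃ be a minimizer over B of b' ↦ r(b') + (1/2)‖A b' − ỹ‖². Then ‖A b̃ − A b‖ ≤ ‖ỹ − y‖; that is, the estimator y ↦ A b̂(y), where b̂(y) is any minimizer of the regularized least-squares objective, is 1-Lipschitz. -/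
open RealInnerProductSpace

/-- First-order optimality condition for a minimizer of the sum of a convex function and a
least-squares term. -/
theorem ConvexOn.sub_add_inner_nonneg_of_isMinimizer
    {B E : Type*} [AddCommGroup B] [Module ℝ B] [NormedAddCommGroup E] [InnerProductSpace ℝ E]
    (A : B →ₗ[ℝ] E) (y : E) {r : B → ℝ} (hr : ConvexOn ℝ Set.univ r) {b : B}
    (hb : ∀ b' : B, r b + (1 / 2) * ‖A b - y‖ ^ 2 ≤ r b' + (1 / 2) * ‖A b' - y‖ ^ 2) (c : B) :
    0 ≤ r c - r b + ⟪A b - y, A c - A b⟫ := by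
  have key : ∀ t : ℝ, 0 < t → t ≤ 1 →
      0 ≤ (r c - r b + ⟪A b - y, A c - A b⟫) + t / 2 * ‖A c - A b‖ ^ 2 := by
    intro t ht ht1
    have hmin := hb ((1 - t) • b + t • c)
    have hconv := hr.2 (Set.mem_univ b) (Set.mem_univ c) (sub_nonneg.2 ht1) ht.le
      (sub_add_cancel 1 t)
    simp only [smul_eq_mul] at hconv
    have hA : A ((1 - t) • b + t • c) - y = (A b - y) + t • (A c - A b) := by
      simp only [map_add, map_smul]
      module
    rw [hA, norm_add_sq_real, real_inner_smul_right, norm_smul, mul_pow, Real.norm_eq_abs,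
      sq_abs] at hmin
    refine nonneg_of_mul_nonneg_right ?_ ht
    linarith
  set X := r c - r b + ⟪A b - y, A c - A b⟫
  have hlim : Filter.Tendsto (fun t : ℝ => X + t / 2 * ‖A c - A b‖ ^ 2)
      (nhdsWithin 0 (Set.Ioi 0)) (nhds X) := by
    have hcont : Continuous fun t : ℝ => X + t / 2 * ‖A c - A b‖ ^ 2 := by fun_prop
    simpa using (hcont.tendsto 0).mono_left nhdsWithin_le_nhds
  refine ge_of_tendsto hlim ?_
  filter_upwards [Ioc_mem_nhdsGT (zero_lt_one' ℝ)] with t ht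
  exact key t ht.1 ht.2

/-- If `b` minimizes `b' ↦ r b' + (1/2)‖A b' − y‖²` and `b̃` minimizes
`b' ↦ r b' + (1/2)‖A b' − ỹ‖²` over a finite-dimensional real inner product space
`B` (with `r` convex), then `‖A b̃ − A b‖ ≤ ‖ỹ − y‖`: the regularized least-squares
estimator is 1-Lipschitz. -/
theorem stmt_2
    {B : Type*} [NormedAddCommGroup B] [InnerProductSpace ℝ B] [FiniteDimensional ℝ B]
    {d : ℕ} (hd : 0 < d)
    (A : B →ₗ[ℝ] EuclideanSpace ℝ (Fin d)) (y ytil : EuclideanSpace ℝ (Fin d))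
    (r : B → ℝ) (hr : ConvexOn ℝ Set.univ r)
    (b btil : B)
    (hb : ∀ b' : B, r b + (1 / 2) * ‖A b - y‖ ^ 2 ≤ r b' + (1 / 2) * ‖A b' - y‖ ^ 2)
    (hbtil : ∀ b' : B,
      r btil + (1 / 2) * ‖A btil - ytil‖ ^ 2 ≤ r b' + (1 / 2) * ‖A b' - ytil‖ ^ 2) :
    ‖A btil - A b‖ ≤ ‖ytil - y‖ := by
  have h₁ := hr.sub_add_inner_nonneg_of_isMinimizer A y hb btil
  have h₂ := hr.sub_add_inner_nonneg_of_isMinimizer A ytil hbtil b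
  rw [← neg_sub (A btil) (A b), inner_neg_right] at h₂
  have hinner : ⟪ytil - y, A btil - A b⟫ =
      ⟪A b - y, A btil - A b⟫ - ⟪A btil - ytil, A btil - A b⟫ + ‖A btil - A b‖ ^ 2 := by
    rw [← real_inner_self_eq_norm_sq, ← inner_sub_left, ← inner_add_left]
    congr 1
    abel
  have hcs := real_inner_le_norm (ytil - y) (A btil - A b)
  by_contra! hlt
  have hpos := (norm_nonneg _).trans_lt hlt
  nlinarith [mul_lt_mul_of_pos_right hlt hpos]
end

section
/- The zero vector 0 ∈ B is a minimizer over B of b ↦ (1/2)‖A b − y‖² + λ N(b) if and only if for every u ∈ B, ⟪A* y, u⟫ ≤ λ N(u) (i.e., the dual norm of A* y with respect to N is at most λ). -/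
open RealInnerProductSpace

/-- A linear inequality holds if it holds up to a quadratic error at every positive scale. -/
theorem le_of_forall_pos_le_add_mul_sq {p q : ℝ} (c : ℝ)
    (h : ∀ t : ℝ, 0 < t → t * p ≤ t * q + t ^ 2 * c / 2) : p ≤ q := by
  have h_tendsto : Filter.Tendsto (fun t : ℝ => q + t * c / 2) (nhdsWithin 0 (Set.Ioi 0))
      (nhds q) := by
    have h_cont : Continuous fun t : ℝ => q + t * c / 2 := by fun_prop
    simpa using (h_cont.tendsto 0).mono_left nhdsWithin_le_nhds
  refine ge_of_tendsto h_tendsto ?_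
  filter_upwards [self_mem_nhdsWithin] with t ht
  refine le_of_mul_le_mul_left ?_ (Set.mem_Ioi.1 ht)
  linarith [h t ht]

/-- `0` minimizes `b ↦ (1/2)‖A b − y‖² + λ N b` over the
finite-dimensional real inner product space `B` (where `N` is a norm on `B`)
if and only if `⟪A* y, u⟫ ≤ λ N u` for every `u`. -/
theorem stmt_3
    {B : Type*} [NormedAddCommGroup B] [InnerProductSpace ℝ B] [FiniteDimensional ℝ B]
    {d : ℕ} (hd : 0 < d)
    (A : B →ₗ[ℝ] EuclideanSpace ℝ (Fin d)) (y : EuclideanSpace ℝ (Fin d))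
    (lam : ℝ) (hlam : 0 < lam)
    (N : B → ℝ)
    (hN_add : ∀ u v : B, N (u + v) ≤ N u + N v)
    (hN_smul : ∀ (c : ℝ) (u : B), N (c • u) = |c| * N u)
    (hN_eq_zero : ∀ u : B, N u = 0 ↔ u = 0) :
    (∀ b : B,
        (1 / 2) * ‖A 0 - y‖ ^ 2 + lam * N 0 ≤ (1 / 2) * ‖A b - y‖ ^ 2 + lam * N b) ↔
      ∀ u : B, ⟪(LinearMap.adjoint A) y, u⟫ ≤ lam * N u := by
  have hN_zero : N 0 = 0 := (hN_eq_zero 0).2 rfl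
  have h_expand (b : B) : ‖A b - y‖ ^ 2 =
      ‖A b‖ ^ 2 - 2 * ⟪(LinearMap.adjoint A) y, b⟫ + ‖y‖ ^ 2 := by
    rw [norm_sub_sq_real, LinearMap.adjoint_inner_left, real_inner_comm]
  constructor
  · intro h u
    refine le_of_forall_pos_le_add_mul_sq (‖A u‖ ^ 2) fun t ht => ?_
    have hu := h (t • u)
    rw [h_expand, h_expand, map_zero, map_smul, hN_zero, hN_smul, abs_of_pos ht, norm_smul,
      Real.norm_of_nonneg ht.le, inner_zero_right, inner_smul_right, norm_zero] at hu
    nlinarith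
  · intro h b
    rw [h_expand, h_expand, map_zero, hN_zero, inner_zero_right, norm_zero]
    nlinarith [h b, sq_nonneg ‖A b‖]
end

section
/- Let η > 0 and σ > 0 with σ ≠ η. Then the function (s, t) ↦ (s·T_η(s) − t·T_η(t)) / (s² − t²) tends to (1/2)·𝟙[σ > η] + T_η(σ)/(2σ) as (s, t) → (σ, σ) along pairs with s ≠ t (where 𝟙[σ > η] equals 1 if σ > η and 0 otherwise). -/
open Filter

/-- for `η > 0`, `σ > 0` with `σ ≠ η`, the function
`(s, t) ↦ (s·T_η(s) − t·T_η(t)) / (s² − t²)` (where `T_η(x) = max (x − η) 0` is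
scalar soft-thresholding) tends to `(1/2)·𝟙[σ > η] + T_η(σ)/(2σ)` as
`(s, t) → (σ, σ)` along pairs with `s ≠ t`. -/
theorem stmt_14 (η σ : ℝ) (hη : 0 < η) (hσ : 0 < σ) (hne : σ ≠ η) :
    Tendsto
      (fun q : ℝ × ℝ =>
        (q.1 * max (q.1 - η) 0 - q.2 * max (q.2 - η) 0) / (q.1 ^ 2 - q.2 ^ 2))
      (nhdsWithin (σ, σ) {q : ℝ × ℝ | q.1 ≠ q.2})
      (nhds ((1 / 2) * (if σ > η then (1 : ℝ) else 0) + max (σ - η) 0 / (2 * σ))) := by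
  rcases hne.lt_or_gt with h | h
  · rw [if_neg (not_lt.mpr h.le), max_eq_right (sub_nonpos.mpr h.le), mul_zero, zero_div, add_zero]
    refine tendsto_const_nhds.congr' ?_
    have hs : ∀ᶠ q : ℝ × ℝ in nhds (σ, σ), q.1 < η ∧ q.2 < η :=
      (continuousAt_fst.eventually_lt continuousAt_const h).and
        (continuousAt_snd.eventually_lt continuousAt_const h)
    filter_upwards [nhdsWithin_le_nhds hs] with q hq
    rw [max_eq_right (sub_nonpos.mpr hq.1.le), max_eq_right (sub_nonpos.mpr hq.2.le)]
    simp
  · have hlim : (1 / 2) * (if σ > η then (1 : ℝ) else 0) + max (σ - η) 0 / (2 * σ)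
        = 1 - η / (σ + σ) := by
      rw [if_pos h, max_eq_left (sub_nonneg.mpr h.le)]
      field_simp
      ring
    have hcont : ContinuousAt (fun q : ℝ × ℝ => 1 - η / (q.1 + q.2)) (σ, σ) :=
      continuousAt_const.sub (continuousAt_const.div
        (continuousAt_fst.add continuousAt_snd) (add_pos hσ hσ).ne')
    rw [hlim]
    refine (hcont.tendsto.mono_left nhdsWithin_le_nhds).congr' ?_
    have hs : ∀ᶠ q : ℝ × ℝ in nhds (σ, σ), η < q.1 ∧ η < q.2 :=
      (continuousAt_const.eventually_lt continuousAt_fst h).and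
        (continuousAt_const.eventually_lt continuousAt_snd h)
    filter_upwards [nhdsWithin_le_nhds hs, self_mem_nhdsWithin] with q hq hst
    have hsub : q.1 - q.2 ≠ 0 := sub_ne_zero.mpr hst
    have hadd : q.1 + q.2 ≠ 0 := (add_pos (hη.trans hq.1) (hη.trans hq.2)).ne'
    rw [max_eq_left (sub_nonneg.mpr hq.1.le), max_eq_left (sub_nonneg.mpr hq.2.le),
      sq_sub_sq]
    field_simp
    ring
end

section
/- Let η > 0 and σ > 0 with σ ≠ η. Then the function (s, t) ↦ (t·T_η(s) − s·T_η(t)) / (s² − t²) tends to (1/2)·𝟙[σ > η] − T_η(σ)/(2σ) as (s, t) → (σ, σ) along pairs with s ≠ t (where 𝟙[σ > η] equals 1 if σ > η and 0 otherwise). -/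
open Filter

/-- for `η > 0`, `σ > 0` with `σ ≠ η`, the function
`(s, t) ↦ (t·T_η(s) − s·T_η(t)) / (s² − t²)` (where `T_η(x) = max (x − η) 0` is
scalar soft-thresholding) tends to `(1/2)·𝟙[σ > η] − T_η(σ)/(2σ)` as
`(s, t) → (σ, σ)` along pairs with `s ≠ t`. -/
theorem stmt_15 (η σ : ℝ) (hη : 0 < η) (hσ : 0 < σ) (hne : σ ≠ η) :
    Tendsto
      (fun q : ℝ × ℝ =>
        (q.2 * max (q.1 - η) 0 - q.1 * max (q.2 - η) 0) / (q.1 ^ 2 - q.2 ^ 2))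
      (nhdsWithin (σ, σ) {q : ℝ × ℝ | q.1 ≠ q.2})
      (nhds ((1 / 2) * (if σ > η then (1 : ℝ) else 0) - max (σ - η) 0 / (2 * σ))) := by
  rcases lt_or_gt_of_ne hne with h | h
  · have hzero : (fun _ : ℝ × ℝ => (0 : ℝ)) =ᶠ[nhdsWithin (σ, σ) {q : ℝ × ℝ | q.1 ≠ q.2}]
        fun q => (q.2 * max (q.1 - η) 0 - q.1 * max (q.2 - η) 0) / (q.1 ^ 2 - q.2 ^ 2) := by
      have hev : ∀ᶠ q in nhds ((σ, σ) : ℝ × ℝ), q.1 < η ∧ q.2 < η :=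
        (continuousAt_fst.eventually_lt continuousAt_const h).and
          (continuousAt_snd.eventually_lt continuousAt_const h)
      filter_upwards [nhdsWithin_le_nhds hev] with q hq
      rw [max_eq_right (by linarith [hq.1]), max_eq_right (by linarith [hq.2])]
      simp
    rw [if_neg (not_lt.mpr h.le), max_eq_right (by linarith)]
    simpa using tendsto_const_nhds.congr' hzero
  · have hquot : (fun q : ℝ × ℝ => η / (q.1 + q.2)) =ᶠ[nhdsWithin (σ, σ) {q : ℝ × ℝ | q.1 ≠ q.2}]
        fun q => (q.2 * max (q.1 - η) 0 - q.1 * max (q.2 - η) 0) / (q.1 ^ 2 - q.2 ^ 2) := by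
      have hev : ∀ᶠ q in nhds ((σ, σ) : ℝ × ℝ), η < q.1 ∧ η < q.2 :=
        (continuousAt_const.eventually_lt continuousAt_fst h).and
          (continuousAt_const.eventually_lt continuousAt_snd h)
      filter_upwards [nhdsWithin_le_nhds hev, self_mem_nhdsWithin] with q hq hqne
      obtain ⟨h₁, h₂⟩ := hq
      have hsub : q.1 - q.2 ≠ 0 := sub_ne_zero.mpr hqne
      have hadd : q.1 + q.2 ≠ 0 := by linarith
      rw [max_eq_left (by linarith), max_eq_left (by linarith), sq_sub_sq,
        div_eq_div_iff hadd (mul_ne_zero hadd hsub)]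
      ring
    have hlim : (1 / 2) * (if σ > η then (1 : ℝ) else 0) - max (σ - η) 0 / (2 * σ)
        = η / (σ + σ) := by
      rw [if_pos h, max_eq_left (by linarith)]
      field_simp
      ring
    rw [hlim]
    have hcont : ContinuousAt (fun q : ℝ × ℝ => η / (q.1 + q.2)) (σ, σ) :=
      continuousAt_const.div (continuousAt_fst.add continuousAt_snd) (by positivity)
    exact (hcont.tendsto.mono_left nhdsWithin_le_nhds).congr' hquot
end
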